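/- There is a positive constant C, independent of the weight, such that for every weight w and every interval J ⊂ ℝ with ⟨log w⟩_J finite: (1/|J|) Σ_{I ∈ 𝒟(J)} (Δ_I w / ⟨w⟩_I)² |I| ≤ C ( log ⟨w⟩_J − ⟨log w⟩_J ). Moreover, if w is doubling with constant D on J (meaning ⟨w⟩_I ≤ D ⟨w⟩_{I⁺} and ⟨w⟩_I ≤ D ⟨w⟩_{I⁻} for every I ∈ 𝒟(J) and I = J), then there exists a constant c > 0 depending only on D such that c ( log ⟨w⟩_J − ⟨log w⟩_J ) ≤ (1/|J|) Σ_{I ∈ 𝒟(J)} (Δ_I w / ⟨w⟩_I)² |I|. -/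

import Mathlib

open MeasureTheory Real
open scoped ENNReal

noncomputable section

/-- The average `⟨w⟩_{[a,b]} = (b-a)⁻¹ ∫_a^b w`. -/
def avg (w : ℝ → ℝ) (a b : ℝ) : ℝ := (b - a)⁻¹ * ∫ x in a..b, w x

/-- A weight: a locally integrable function on `ℝ` that is positive almost everywhere. -/
def IsWeight (w : ℝ → ℝ) : Prop :=
  LocallyIntegrable w volume ∧ ∀ᵐ x : ℝ, 0 < w x

/-- Endpoints of the `k`-th subinterval of `[a,b]` at bisection level `n`; as `n, k` range over
`n : ℕ`, `k < 2^n` these enumerate the family `𝒟(J)` obtained from `J = [a,b]` by repeated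
bisection (including `J` itself, for `n = 0`). -/
def subInt (a b : ℝ) (n k : ℕ) : ℝ × ℝ :=
  (a + k * ((b - a) / 2 ^ n), a + (k + 1) * ((b - a) / 2 ^ n))

/-- Midpoint of an interval. -/
def mid (a b : ℝ) : ℝ := (a + b) / 2

/-- `Δ_I w` for `I = [a,b]`: the difference of the averages of `w` over the two halves of `I`. -/
def delta (w : ℝ → ℝ) (a b : ℝ) : ℝ := avg w a (mid a b) - avg w (mid a b) b

/-- `(1/|J|) Σ_{I ∈ 𝒟(J)} (Δ_I w)² g(⟨w⟩_I) |I|` for `J = [a,b]`. -/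
def bellmanSum (w : ℝ → ℝ) (a b : ℝ) (g : ℝ → ℝ) : ℝ :=
  (b - a)⁻¹ * ∑' n : ℕ, ∑ k ∈ Finset.range (2 ^ n),
    delta w (subInt a b n k).1 (subInt a b n k).2 ^ 2 *
      g (avg w (subInt a b n k).1 (subInt a b n k).2) * ((b - a) / 2 ^ n)

/-- `(1/|J|) Σ_{I ∈ 𝒟(J)} (Δ_I w / ⟨w⟩_I)² g(⟨w⟩_I) |I|` for `J = [a,b]`. -/
def buckleySum (w : ℝ → ℝ) (a b : ℝ) (g : ℝ → ℝ) : ℝ :=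
  (b - a)⁻¹ * ∑' n : ℕ, ∑ k ∈ Finset.range (2 ^ n),
    (delta w (subInt a b n k).1 (subInt a b n k).2 /
        avg w (subInt a b n k).1 (subInt a b n k).2) ^ 2 *
      g (avg w (subInt a b n k).1 (subInt a b n k).2) * ((b - a) / 2 ^ n)

/-- `ℝ≥0∞`-valued version of `buckleySum` (the summands are nonnegative). -/
def buckleySumE (w : ℝ → ℝ) (a b : ℝ) (g : ℝ → ℝ) : ℝ≥0∞ :=
  ENNReal.ofReal ((b - a)⁻¹) * ∑' n : ℕ, ∑ k ∈ Finset.range (2 ^ n),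
    ENNReal.ofReal
      ((delta w (subInt a b n k).1 (subInt a b n k).2 /
          avg w (subInt a b n k).1 (subInt a b n k).2) ^ 2 *
        g (avg w (subInt a b n k).1 (subInt a b n k).2) * ((b - a) / 2 ^ n))

/-- `w` is doubling with constant `D` on the bisection family of `[a,b]`:
`⟨w⟩_I ≤ D ⟨w⟩_{I⁺}` and `⟨w⟩_I ≤ D ⟨w⟩_{I⁻}` for every `I ∈ 𝒟(J)` (including `I = J`). -/
def DoublingOn (D : ℝ) (w : ℝ → ℝ) (a b : ℝ) : Prop :=
  ∀ n : ℕ, ∀ k < 2 ^ n,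
    avg w (subInt a b n k).1 (subInt a b n k).2 ≤
        D * avg w (subInt a b n k).1 (mid (subInt a b n k).1 (subInt a b n k).2) ∧
      avg w (subInt a b n k).1 (subInt a b n k).2 ≤
        D * avg w (mid (subInt a b n k).1 (subInt a b n k).2) (subInt a b n k).2

/-- Endpoints of the dyadic interval `[k·2^{-j}, (k+1)·2^{-j})` of the grid `𝒟`. -/
def dyad (j k : ℤ) : ℝ × ℝ := ((k : ℝ) * (2 : ℝ) ^ (-j), ((k : ℝ) + 1) * (2 : ℝ) ^ (-j))

/-- `w` is dyadically doubling with constant `D`: the average over any dyadic interval is at most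
`D` times the average over each of its two dyadic children, i.e. `⟨w⟩_{F(I)} ≤ D ⟨w⟩_I` for every
`I ∈ 𝒟` with dyadic parent `F(I)`. -/
def DyadicDoubling (D : ℝ) (w : ℝ → ℝ) : Prop :=
  ∀ j k : ℤ,
    avg w (dyad j k).1 (dyad j k).2 ≤
        D * avg w (dyad (j + 1) (2 * k)).1 (dyad (j + 1) (2 * k)).2 ∧
      avg w (dyad j k).1 (dyad j k).2 ≤
        D * avg w (dyad (j + 1) (2 * k + 1)).1 (dyad (j + 1) (2 * k + 1)).2

open Set Filter Topology

/-- The average of `w` over the `k`-th interval of bisection level `n` of `[a,b]`. -/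
def levelAvg (w : ℝ → ℝ) (a b : ℝ) (n k : ℕ) : ℝ :=
  avg w (subInt a b n k).1 (subInt a b n k).2

/-- The squared relative oscillation of `w` on the `k`-th interval of bisection level `n`. -/
def levelOsc (w : ℝ → ℝ) (a b : ℝ) (n k : ℕ) : ℝ :=
  (delta w (subInt a b n k).1 (subInt a b n k).2 / levelAvg w a b n k) ^ 2

/-- The integral over `[a,b]` of `log` of the level `n` averages of `w`. -/
def levelLog (w : ℝ → ℝ) (a b : ℝ) (n : ℕ) : ℝ :=
  ∑ k ∈ Finset.range (2 ^ n), Real.log (levelAvg w a b n k) * ((b - a) / 2 ^ n)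

lemma sum_range_two_mul (f : ℕ → ℝ) (N : ℕ) :
    ∑ k ∈ Finset.range (2 * N), f k =
      ∑ k ∈ Finset.range N, (f (2 * k) + f (2 * k + 1)) := by
  induction N with
  | zero => simp
  | succ N ih =>
    rw [show 2 * (N + 1) = 2 * N + 1 + 1 by ring, Finset.sum_range_succ, Finset.sum_range_succ, ih,
      Finset.sum_range_succ]
    ring

lemma sq_div_mean_le_log_gap {p q : ℝ} (hp : 0 < p) (hq : 0 < q) :
    ((p - q) / ((p + q) / 2)) ^ 2 ≤
      8 * (Real.log ((p + q) / 2) - (Real.log p + Real.log q) / 2) := by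
  have hm : 0 < (p + q) / 2 := by positivity
  have h := Real.log_le_sub_one_of_pos (show 0 < p * q / ((p + q) / 2) ^ 2 by positivity)
  rw [Real.log_div (by positivity) (by positivity), Real.log_mul hp.ne' hq.ne', Real.log_pow] at h
  have e : p * q / ((p + q) / 2) ^ 2 - 1 = -(1 / 4) * ((p - q) / ((p + q) / 2)) ^ 2 := by
    field_simp
    ring
  rw [e] at h
  push_cast at h
  linarith

lemma log_gap_le_sq_div_mean {D p q : ℝ} (hp : 0 < p) (hq : 0 < q)
    (h1 : (p + q) / 2 ≤ D * p) (h2 : (p + q) / 2 ≤ D * q) :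
    8 * (Real.log ((p + q) / 2) - (Real.log p + Real.log q) / 2) ≤
      D * ((p - q) / ((p + q) / 2)) ^ 2 := by
  have hm : 0 < (p + q) / 2 := by positivity
  have h := Real.log_le_sub_one_of_pos (show 0 < ((p + q) / 2) ^ 2 / (p * q) by positivity)
  rw [Real.log_div (by positivity) (by positivity), Real.log_mul hp.ne' hq.ne', Real.log_pow] at h
  have e : ((p + q) / 2) ^ 2 / (p * q) - 1 = (p - q) ^ 2 / 4 / (p * q) := by
    field_simp
    ring
  have key : ((p + q) / 2) ^ 2 ≤ D * (p * q) := by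
    rcases le_total p q with hpq | hpq <;> nlinarith
  have h3 : (p - q) ^ 2 / 4 / (p * q) ≤ D * ((p - q) / ((p + q) / 2)) ^ 2 / 4 := by
    rw [div_pow, div_le_iff₀ (by positivity)]
    have : D * ((p - q) ^ 2 / ((p + q) / 2) ^ 2) / 4 * (p * q) =
        (p - q) ^ 2 / 4 * (D * (p * q) / ((p + q) / 2) ^ 2) := by ring
    rw [this]
    exact le_mul_of_one_le_right (by positivity) ((one_le_div (by positivity)).2 key)
  rw [e] at h
  push_cast at h
  linarith

lemma IsWeight.intervalIntegrable {w : ℝ → ℝ} (hw : IsWeight w) (a b : ℝ) :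
    IntervalIntegrable w volume a b :=
  (hw.1.integrableOn_isCompact isCompact_uIcc).intervalIntegrable

lemma IsWeight.avg_pos {w : ℝ → ℝ} (hw : IsWeight w) {a b : ℝ} (hab : a < b) :
    0 < avg w a b := by
  refine mul_pos (inv_pos.2 (sub_pos.2 hab)) ?_
  rw [intervalIntegral.integral_pos_iff_support_of_nonneg_ae
    (hw.2.mono fun x hx => hx.le) (hw.intervalIntegrable a b)]
  refine ⟨hab, ?_⟩
  have h : (Function.support w ∩ Ioc a b : Set ℝ) =ᵐ[volume] Ioc a b := by
    filter_upwards [hw.2] with x hx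
    refine propext ⟨fun h => h.2, fun h => ⟨hx.ne', h⟩⟩
  rw [measure_congr h, Real.volume_Ioc]
  simpa using hab

lemma integral_eq_avg (w : ℝ → ℝ) {a b : ℝ} (hab : a < b) :
    ∫ x in a..b, w x = avg w a b * (b - a) := by
  have := (sub_pos.2 hab).ne'
  rw [avg]
  field_simp

/-- Jensen's inequality for the logarithm on an interval. -/
lemma IsWeight.integral_log_le {w : ℝ → ℝ} (hw : IsWeight w) {a b : ℝ} (hab : a < b)
    (hlog : IntervalIntegrable (fun x => Real.log (w x)) volume a b) :
    ∫ x in a..b, Real.log (w x) ≤ Real.log (avg w a b) * (b - a) := by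
  have hm := hw.avg_pos hab
  have hi := hw.intervalIntegrable a b
  have h : ∫ x in a..b, Real.log (w x) ≤
      ∫ x in a..b, ((avg w a b)⁻¹ * w x + (Real.log (avg w a b) - 1)) := by
    refine intervalIntegral.integral_mono_ae hab.le hlog
      ((hi.const_mul _).add intervalIntegrable_const) ?_
    filter_upwards [hw.2] with x hx
    have := Real.log_le_sub_one_of_pos (mul_pos (inv_pos.2 hm) hx)
    rw [Real.log_mul (inv_pos.2 hm).ne' hx.ne', Real.log_inv] at this
    linarith
  rw [intervalIntegral.integral_add (hi.const_mul _) intervalIntegrable_const,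
    intervalIntegral.integral_const_mul, integral_eq_avg w hab, ← mul_assoc,
    inv_mul_cancel₀ hm.ne', intervalIntegral.integral_const, smul_eq_mul] at h
  linarith

lemma subInt_lt {a b : ℝ} (hab : a < b) (n k : ℕ) :
    (subInt a b n k).1 < (subInt a b n k).2 := by
  have : 0 < (b - a) / 2 ^ n := div_pos (sub_pos.2 hab) (by positivity)
  simp only [subInt]
  linarith

lemma subInt_sub (a b : ℝ) (n k : ℕ) :
    (subInt a b n k).2 - (subInt a b n k).1 = (b - a) / 2 ^ n := by
  simp only [subInt]
  ring

lemma subInt_children (a b : ℝ) (n k : ℕ) :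
    subInt a b (n + 1) (2 * k) =
        ((subInt a b n k).1, mid (subInt a b n k).1 (subInt a b n k).2) ∧
      subInt a b (n + 1) (2 * k + 1) =
        (mid (subInt a b n k).1 (subInt a b n k).2, (subInt a b n k).2) := by
  simp only [subInt, mid, Prod.mk.injEq]
  push_cast
  refine ⟨⟨?_, ?_⟩, ?_, ?_⟩ <;> (field_simp; try ring)

lemma left_subInt_zero (a b : ℝ) (n : ℕ) : a + ((0 : ℕ) : ℝ) * ((b - a) / 2 ^ n) = a := by simp

lemma right_subInt_last (a b : ℝ) (n : ℕ) :
    a + ((2 ^ n : ℕ) : ℝ) * ((b - a) / 2 ^ n) = b := by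
  push_cast
  field_simp
  ring

lemma IsWeight.levelAvg_pos {w : ℝ → ℝ} (hw : IsWeight w) {a b : ℝ} (hab : a < b) (n k : ℕ) :
    0 < levelAvg w a b n k :=
  hw.avg_pos (subInt_lt hab n k)

lemma avg_eq_avg_halves {w : ℝ → ℝ} (hw : ∀ a b, IntervalIntegrable w volume a b) {a b : ℝ}
    (hab : a < b) : avg w a b = (avg w a (mid a b) + avg w (mid a b) b) / 2 := by
  have h1 : a < mid a b := by simp only [mid]; linarith
  have h2 : mid a b < b := by simp only [mid]; linarith
  have h := intervalIntegral.integral_add_adjacent_intervals (hw a (mid a b)) (hw (mid a b) b)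
  rw [integral_eq_avg w h1, integral_eq_avg w h2, integral_eq_avg w hab] at h
  have e1 : mid a b - a = (b - a) / 2 := by simp only [mid]; ring
  have e2 : b - mid a b = (b - a) / 2 := by simp only [mid]; ring
  rw [e1, e2] at h
  have := sub_pos.2 hab
  apply mul_right_cancel₀ this.ne'
  linarith

lemma IsWeight.levelAvg_eq {w : ℝ → ℝ} (hw : IsWeight w) {a b : ℝ} (hab : a < b) (n k : ℕ) :
    levelAvg w a b n k =
      (levelAvg w a b (n + 1) (2 * k) + levelAvg w a b (n + 1) (2 * k + 1)) / 2 := by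
  obtain ⟨e1, e2⟩ := subInt_children a b n k
  simp only [levelAvg, e1, e2]
  exact avg_eq_avg_halves hw.intervalIntegrable (subInt_lt hab n k)

lemma IsWeight.levelOsc_eq {w : ℝ → ℝ} (hw : IsWeight w) {a b : ℝ} (hab : a < b) (n k : ℕ) :
    levelOsc w a b n k =
      ((levelAvg w a b (n + 1) (2 * k) - levelAvg w a b (n + 1) (2 * k + 1)) /
        ((levelAvg w a b (n + 1) (2 * k) + levelAvg w a b (n + 1) (2 * k + 1)) / 2)) ^ 2 := by
  rw [← hw.levelAvg_eq hab]
  obtain ⟨e1, e2⟩ := subInt_children a b n k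
  simp only [levelOsc, delta, levelAvg, e1, e2]

lemma levelLog_sub_succ (w : ℝ → ℝ) (a b : ℝ) (n : ℕ) :
    levelLog w a b n - levelLog w a b (n + 1) =
      ∑ k ∈ Finset.range (2 ^ n), (Real.log (levelAvg w a b n k) -
        (Real.log (levelAvg w a b (n + 1) (2 * k)) +
          Real.log (levelAvg w a b (n + 1) (2 * k + 1))) / 2) * ((b - a) / 2 ^ n) := by
  rw [levelLog, levelLog, pow_succ', sum_range_two_mul, ← Finset.sum_sub_distrib]
  refine Finset.sum_congr rfl fun k _ => ?_
  rw [show (b - a) / 2 ^ (n + 1) = (b - a) / 2 ^ n / 2 by field_simp; ring]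
  ring

lemma IsWeight.sum_levelOsc_le {w : ℝ → ℝ} (hw : IsWeight w) {a b : ℝ} (hab : a < b) (N : ℕ) :
    ∑ n ∈ Finset.range N, ∑ k ∈ Finset.range (2 ^ n), levelOsc w a b n k * ((b - a) / 2 ^ n) ≤
      8 * (levelLog w a b 0 - levelLog w a b N) := by
  rw [← Finset.sum_range_sub', Finset.mul_sum]
  refine Finset.sum_le_sum fun n _ => ?_
  rw [levelLog_sub_succ, Finset.mul_sum]
  refine Finset.sum_le_sum fun k _ => ?_
  rw [← mul_assoc]
  refine mul_le_mul_of_nonneg_right ?_ (div_nonneg (sub_pos.2 hab).le (by positivity))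
  rw [hw.levelOsc_eq hab, hw.levelAvg_eq hab n k]
  exact sq_div_mean_le_log_gap (hw.levelAvg_pos hab _ _) (hw.levelAvg_pos hab _ _)

lemma IsWeight.le_sum_levelOsc {w : ℝ → ℝ} (hw : IsWeight w) {a b : ℝ} (hab : a < b) {D : ℝ}
    (hD : DoublingOn D w a b) (N : ℕ) :
    8 * (levelLog w a b 0 - levelLog w a b N) ≤ D *
      ∑ n ∈ Finset.range N, ∑ k ∈ Finset.range (2 ^ n),
        levelOsc w a b n k * ((b - a) / 2 ^ n) := by
  rw [← Finset.sum_range_sub', Finset.mul_sum, Finset.mul_sum]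
  refine Finset.sum_le_sum fun n _ => ?_
  rw [levelLog_sub_succ, Finset.mul_sum, Finset.mul_sum]
  refine Finset.sum_le_sum fun k hk => ?_
  rw [← mul_assoc, ← mul_assoc]
  refine mul_le_mul_of_nonneg_right ?_ (div_nonneg (sub_pos.2 hab).le (by positivity))
  rw [hw.levelOsc_eq hab, hw.levelAvg_eq hab n k]
  have h : levelAvg w a b n k ≤ D * levelAvg w a b (n + 1) (2 * k) ∧
      levelAvg w a b n k ≤ D * levelAvg w a b (n + 1) (2 * k + 1) := by
    obtain ⟨e1, e2⟩ := subInt_children a b n k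
    simp only [levelAvg, e1, e2]
    exact hD n k (Finset.mem_range.1 hk)
  rw [hw.levelAvg_eq hab n k] at h
  exact log_gap_le_sq_div_mean (hw.levelAvg_pos hab _ _) (hw.levelAvg_pos hab _ _) h.1 h.2

lemma levelLog_zero (w : ℝ → ℝ) (a b : ℝ) :
    levelLog w a b 0 = Real.log (avg w a b) * (b - a) := by
  simp [levelLog, levelAvg, subInt]

lemma subInt_subset {a b : ℝ} (hab : a < b) {n k : ℕ} (hk : k < 2 ^ n) :
    uIcc (subInt a b n k).1 (subInt a b n k).2 ⊆ uIcc a b := by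
  have h0 : 0 < (b - a) / 2 ^ n := div_pos (sub_pos.2 hab) (by positivity)
  rw [uIcc_of_le (subInt_lt hab n k).le, uIcc_of_le hab.le]
  refine Icc_subset_Icc ?_ ?_
  · have : 0 ≤ (k : ℝ) * ((b - a) / 2 ^ n) := by positivity
    simp only [subInt]
    linarith
  · have h1 : ((k : ℝ) + 1) ≤ ((2 ^ n : ℕ) : ℝ) := by exact_mod_cast hk
    have h2 := mul_le_mul_of_nonneg_right h1 h0.le
    have h3 := right_subInt_last a b n
    simp only [subInt]
    linarith

/-- Splitting an integral over the intervals of bisection level `n`. -/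
lemma sum_integral_subInt {f : ℝ → ℝ} {a b : ℝ} (n : ℕ)
    (hf : ∀ k < 2 ^ n, IntervalIntegrable f volume (subInt a b n k).1 (subInt a b n k).2) :
    ∑ k ∈ Finset.range (2 ^ n), ∫ x in (subInt a b n k).1..(subInt a b n k).2, f x =
      ∫ x in a..b, f x := by
  have h := intervalIntegral.sum_integral_adjacent_intervals (f := f) (μ := volume)
    (a := fun k : ℕ => a + (k : ℝ) * ((b - a) / 2 ^ n)) (n := 2 ^ n)
    (fun k hk => by simpa [subInt] using hf k hk)
  rw [left_subInt_zero, right_subInt_last] at h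
  rw [← h]
  simp [subInt]

lemma IsWeight.integral_log_le_levelLog {w : ℝ → ℝ} (hw : IsWeight w) {a b : ℝ} (hab : a < b)
    (hlog : IntervalIntegrable (fun x => Real.log (w x)) volume a b) (n : ℕ) :
    ∫ x in a..b, Real.log (w x) ≤ levelLog w a b n := by
  have hi : ∀ k < 2 ^ n, IntervalIntegrable (fun x => Real.log (w x)) volume
      (subInt a b n k).1 (subInt a b n k).2 := fun k hk => hlog.mono_set (subInt_subset hab hk)
  rw [← sum_integral_subInt n hi]
  refine Finset.sum_le_sum fun k hk => ?_
  rw [← subInt_sub a b n k]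
  exact hw.integral_log_le (subInt_lt hab n k) (hi k (Finset.mem_range.1 hk))

/-- The index of the interval of bisection level `n` containing `x`. -/
def levelIndex (a b : ℝ) (n : ℕ) (x : ℝ) : ℕ := ⌊(x - a) / ((b - a) / 2 ^ n)⌋₊

lemma measurable_levelIndex (a b : ℝ) (n : ℕ) : Measurable (levelIndex a b n) :=
  Nat.measurable_floor.comp (by fun_prop)

lemma levelIndex_eq_iff {a b : ℝ} (hab : a < b) (n k : ℕ) {x : ℝ} (hx : a ≤ x) :
    levelIndex a b n x = k ↔ x ∈ Ico (subInt a b n k).1 (subInt a b n k).2 := by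
  have h0 : 0 < (b - a) / 2 ^ n := div_pos (sub_pos.2 hab) (by positivity)
  rw [levelIndex, Nat.floor_eq_iff (div_nonneg (sub_nonneg.2 hx) h0.le), le_div_iff₀ h0,
    div_lt_iff₀ h0]
  simp only [subInt, mem_Ico]
  constructor <;> rintro ⟨h1, h2⟩ <;> constructor <;> linarith

lemma left_le_subInt {a b : ℝ} (hab : a < b) (n k : ℕ) : a ≤ (subInt a b n k).1 := by
  have h0 : 0 < (b - a) / 2 ^ n := div_pos (sub_pos.2 hab) (by positivity)
  have : 0 ≤ (k : ℝ) * ((b - a) / 2 ^ n) := by positivity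
  simp only [subInt]
  linarith

lemma ae_eq_const_subInt {a b : ℝ} (hab : a < b) (f : ℕ → ℝ) (n k : ℕ) :
    ∀ᵐ x, x ∈ Set.uIoc (subInt a b n k).1 (subInt a b n k).2 → f (levelIndex a b n x) = f k := by
  have h : ∀ᵐ x : ℝ, x ≠ (subInt a b n k).2 := by simp [ae_iff]
  filter_upwards [h] with x hx hx'
  rw [uIoc_of_le (subInt_lt hab n k).le] at hx'
  rw [(levelIndex_eq_iff hab n k ((left_le_subInt hab n k).trans hx'.1.le)).2
    ⟨hx'.1.le, lt_of_le_of_ne hx'.2 hx⟩]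

lemma intervalIntegrable_step_subInt {a b : ℝ} (hab : a < b) (f : ℕ → ℝ) (n k : ℕ) :
    IntervalIntegrable (fun x => f (levelIndex a b n x)) volume
      (subInt a b n k).1 (subInt a b n k).2 := by
  refine (intervalIntegrable_const (c := f k)).congr_ae ?_
  rw [Filter.EventuallyEq, ae_restrict_iff' measurableSet_uIoc]
  filter_upwards [ae_eq_const_subInt hab f n k] with x hx h
  exact (hx h).symm

lemma intervalIntegrable_step {a b : ℝ} (hab : a < b) (f : ℕ → ℝ) (n : ℕ) :
    IntervalIntegrable (fun x => f (levelIndex a b n x)) volume a b := by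
  have h := IntervalIntegrable.trans_iterate (μ := volume)
    (f := fun x => f (levelIndex a b n x))
    (a := fun k : ℕ => a + (k : ℝ) * ((b - a) / 2 ^ n)) (n := 2 ^ n)
    (fun k _ => by simpa [subInt] using intervalIntegrable_step_subInt hab f n k)
  rwa [left_subInt_zero, right_subInt_last] at h

lemma integral_step {a b : ℝ} (hab : a < b) (f : ℕ → ℝ) (n : ℕ) :
    ∫ x in a..b, f (levelIndex a b n x) =
      ∑ k ∈ Finset.range (2 ^ n), f k * ((b - a) / 2 ^ n) := by
  rw [← sum_integral_subInt n fun k _ => intervalIntegrable_step_subInt hab f n k]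
  refine Finset.sum_congr rfl fun k _ => ?_
  rw [intervalIntegral.integral_congr_ae (ae_eq_const_subInt hab f n k),
    intervalIntegral.integral_const, subInt_sub, smul_eq_mul, mul_comm]

lemma setAverage_closedBall_eq_avg (w : ℝ → ℝ) {a b : ℝ} (hab : a < b) :
    ⨍ x in Metric.closedBall ((a + b) / 2) ((b - a) / 2), w x = avg w a b := by
  rw [Real.closedBall_eq_Icc, show (a + b) / 2 - (b - a) / 2 = a by ring,
    show (a + b) / 2 + (b - a) / 2 = b by ring, setAverage_eq, avg,
    intervalIntegral.integral_of_le hab.le, integral_Icc_eq_integral_Ioc, smul_eq_mul]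
  simp [measureReal_def, hab.le]

/-- Lebesgue differentiation along the bisection intervals. -/
lemma ae_tendsto_levelAvg {w : ℝ → ℝ} (hw : LocallyIntegrable w volume) {a b : ℝ} (hab : a < b) :
    ∀ᵐ x, a ≤ x →
      Tendsto (fun n => levelAvg w a b n (levelIndex a b n x)) atTop (𝓝 (w x)) := by
  filter_upwards [IsUnifLocDoublingMeasure.ae_tendsto_average (μ := volume) hw 1] with x hx hax
  have hab' := sub_pos.2 hab
  have h := hx (l := atTop)
    (fun n : ℕ => ((subInt a b n (levelIndex a b n x)).1 +
      (subInt a b n (levelIndex a b n x)).2) / 2) (fun n : ℕ => (b - a) / 2 ^ n / 2) ?_ ?_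
  · refine h.congr fun n => ?_
    rw [← subInt_sub a b n (levelIndex a b n x),
      setAverage_closedBall_eq_avg w (subInt_lt hab _ _), levelAvg]
  · refine tendsto_nhdsWithin_iff.2 ⟨?_, Eventually.of_forall fun n => ?_⟩
    · have := (tendsto_pow_atTop_nhds_zero_of_lt_one (r := (1 / 2 : ℝ)) (by norm_num)
        (by norm_num)).const_mul ((b - a) / 2)
      rw [mul_zero] at this
      refine this.congr fun n => ?_
      rw [one_div, inv_pow]
      ring
    · exact mem_Ioi.2 (by positivity)
  · refine Eventually.of_forall fun n => ?_
    have hm := (levelIndex_eq_iff hab n _ hax).1 rfl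
    rw [one_mul, Real.closedBall_eq_Icc, ← subInt_sub a b n (levelIndex a b n x)]
    constructor <;> linarith [hm.1, hm.2]

/-- A lower bound for all the level logarithms passes to the limit (Fatou's lemma applied to
`w - log w`). -/
lemma IsWeight.le_integral_log {w : ℝ → ℝ} (hw : IsWeight w) {a b : ℝ} (hab : a < b)
    (hlog : IntervalIntegrable (fun x => Real.log (w x)) volume a b) {s : ℝ}
    (hs : ∀ n, s ≤ levelLog w a b n) : s ≤ ∫ x in a..b, Real.log (w x) := by
  have hi := hw.intervalIntegrable a b
  have hpos : ∀ {y : ℝ}, 0 < y → 0 ≤ y - Real.log y := fun hy => by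
    linarith [Real.log_le_sub_one_of_pos hy]
  set g : ℕ → ℕ → ℝ := fun n k => levelAvg w a b n k - Real.log (levelAvg w a b n k) with hg
  set μ := volume.restrict (Ioc a b) with hμ
  have hint : ∀ n, ∫⁻ x, ENNReal.ofReal (g n (levelIndex a b n x)) ∂μ ≤
      ENNReal.ofReal ((∫ x in a..b, w x) - s) := fun n => by
    rw [← ofReal_integral_eq_lintegral_ofReal (intervalIntegrable_step hab (g n) n).1
      (Eventually.of_forall fun x => hpos (hw.levelAvg_pos hab _ _)),
      ← intervalIntegral.integral_of_le hab.le, integral_step hab (g n) n]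
    refine ENNReal.ofReal_le_ofReal ?_
    have e : ∑ k ∈ Finset.range (2 ^ n), levelAvg w a b n k * ((b - a) / 2 ^ n) =
        ∫ x in a..b, w x := by
      rw [← sum_integral_subInt n fun k _ => hw.intervalIntegrable _ _]
      refine Finset.sum_congr rfl fun k _ => ?_
      rw [integral_eq_avg w (subInt_lt hab n k), subInt_sub, levelAvg]
    have := hs n
    simp only [hg, sub_mul, Finset.sum_sub_distrib, e]
    rw [levelLog] at this
    linarith
  have hlim : ∀ᵐ x ∂μ, liminf (fun n => ENNReal.ofReal (g n (levelIndex a b n x))) atTop =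
      ENNReal.ofReal (w x - Real.log (w x)) := by
    rw [hμ, ae_restrict_iff' measurableSet_Ioc]
    filter_upwards [hw.2, ae_tendsto_levelAvg hw.1 hab] with x hx hx' hmem
    have ht := hx' hmem.1.le
    exact (ENNReal.tendsto_ofReal (ht.sub (ht.log hx.ne'))).liminf_eq
  have hfatou := lintegral_liminf_le (μ := μ) (u := atTop)
    (f := fun n x => ENNReal.ofReal (g n (levelIndex a b n x)))
    (fun n => ((measurable_from_nat (f := g n)).comp
      (measurable_levelIndex a b n)).ennreal_ofReal)
  rw [lintegral_congr_ae hlim] at hfatou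
  have hle := hfatou.trans (liminf_le_of_frequently_le' (Frequently.of_forall hint))
  have hnn : 0 ≤ᵐ[μ] fun x => w x - Real.log (w x) :=
    ae_restrict_of_ae (hw.2.mono fun x hx => hpos hx)
  rw [← ofReal_integral_eq_lintegral_ofReal (hi.sub hlog).1 hnn,
    ← intervalIntegral.integral_of_le hab.le, intervalIntegral.integral_sub hi hlog] at hle
  have hws : 0 ≤ (∫ x in a..b, w x) - s := by
    have h0 := hs 0
    rw [levelLog_zero] at h0
    have h1 := mul_nonneg (hpos (hw.avg_pos hab)) (sub_pos.2 hab).le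
    rw [integral_eq_avg w hab]
    linarith
  have := (ENNReal.ofReal_le_ofReal_iff hws).1 hle
  linarith

lemma buckleySum_one_eq (w : ℝ → ℝ) (a b : ℝ) :
    buckleySum w a b (fun _ => (1 : ℝ)) = (b - a)⁻¹ * ∑' n : ℕ,
      ∑ k ∈ Finset.range (2 ^ n), levelOsc w a b n k * ((b - a) / 2 ^ n) := by
  simp only [buckleySum, levelOsc, levelAvg, mul_one]

lemma level_sum_nonneg (w : ℝ → ℝ) {a b : ℝ} (hab : a < b) (n : ℕ) :
    0 ≤ ∑ k ∈ Finset.range (2 ^ n), levelOsc w a b n k * ((b - a) / 2 ^ n) :=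
  Finset.sum_nonneg fun k _ =>
    mul_nonneg (sq_nonneg _) (div_nonneg (sub_pos.2 hab).le (by positivity))

lemma IsWeight.sum_levelOsc_le_log_gap {w : ℝ → ℝ} (hw : IsWeight w) {a b : ℝ} (hab : a < b)
    (hlog : IntervalIntegrable (fun x => Real.log (w x)) volume a b) (N : ℕ) :
    ∑ n ∈ Finset.range N, ∑ k ∈ Finset.range (2 ^ n), levelOsc w a b n k * ((b - a) / 2 ^ n) ≤
      8 * (Real.log (avg w a b) * (b - a) - ∫ x in a..b, Real.log (w x)) := by
  refine (hw.sum_levelOsc_le hab N).trans ?_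
  rw [levelLog_zero]
  linarith [hw.integral_log_le_levelLog hab hlog N]

lemma log_gap_eq (w : ℝ → ℝ) {a b : ℝ} (hab : a < b) :
    Real.log (avg w a b) - avg (fun x => Real.log (w x)) a b =
      (b - a)⁻¹ * (Real.log (avg w a b) * (b - a) - ∫ x in a..b, Real.log (w x)) := by
  have := (sub_pos.2 hab).ne'
  rw [avg.eq_1 (fun x => Real.log (w x)), mul_sub]
  congr 1
  field_simp

lemma DoublingOn.mono {D D' : ℝ} {w : ℝ → ℝ} {a b : ℝ} (hD : DoublingOn D w a b)
    (hw : IsWeight w) (hab : a < b) (h : D ≤ D') : DoublingOn D' w a b := by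
  intro n k hk
  obtain ⟨e1, e2⟩ := subInt_children a b n k
  have p1 := hw.levelAvg_pos hab (n + 1) (2 * k)
  have p2 := hw.levelAvg_pos hab (n + 1) (2 * k + 1)
  simp only [levelAvg, e1, e2] at p1 p2
  exact ⟨(hD n k hk).1.trans (mul_le_mul_of_nonneg_right h p1.le),
    (hD n k hk).2.trans (mul_le_mul_of_nonneg_right h p2.le)⟩

/-- Theorem II.6, case `A(x) = -log x`. -/
theorem buckleySum_comparable_log :
    (∃ C : ℝ, 0 < C ∧ ∀ w : ℝ → ℝ, IsWeight w → ∀ a b : ℝ, a < b →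
      IntervalIntegrable (fun x => Real.log (w x)) volume a b →
      buckleySum w a b (fun _ => (1 : ℝ)) ≤
        C * (Real.log (avg w a b) - avg (fun x => Real.log (w x)) a b)) ∧
    ∀ D : ℝ, ∃ c : ℝ, 0 < c ∧ ∀ w : ℝ → ℝ, IsWeight w → ∀ a b : ℝ, a < b →
      IntervalIntegrable (fun x => Real.log (w x)) volume a b →
      DoublingOn D w a b →
      c * (Real.log (avg w a b) - avg (fun x => Real.log (w x)) a b) ≤
        buckleySum w a b (fun _ => (1 : ℝ)) := by
  constructor
  · refine ⟨8, by norm_num, fun w hw a b hab hlog => ?_⟩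
    rw [buckleySum_one_eq, log_gap_eq w hab, mul_left_comm]
    exact mul_le_mul_of_nonneg_left
      (Real.tsum_le_of_sum_range_le (level_sum_nonneg w hab)
        (hw.sum_levelOsc_le_log_gap hab hlog)) (inv_nonneg.2 (sub_pos.2 hab).le)
  · intro D
    have hD' : 0 < max D 1 := lt_max_of_lt_right one_pos
    refine ⟨8 / max D 1, by positivity, fun w hw a b hab hlog hD => ?_⟩
    rw [buckleySum_one_eq, log_gap_eq w hab, mul_left_comm]
    refine mul_le_mul_of_nonneg_left ?_ (inv_nonneg.2 (sub_pos.2 hab).le)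
    have hsum := summable_of_sum_range_le (level_sum_nonneg w hab)
      (hw.sum_levelOsc_le_log_gap hab hlog)
    set B := ∑' n : ℕ, ∑ k ∈ Finset.range (2 ^ n), levelOsc w a b n k * ((b - a) / 2 ^ n)
    have key := hw.le_integral_log hab hlog
      (s := Real.log (avg w a b) * (b - a) - max D 1 * B / 8) fun n => by
        have h1 := hw.le_sum_levelOsc hab (hD.mono hw hab (le_max_left D 1)) n
        have h2 := mul_le_mul_of_nonneg_left
          (hsum.sum_le_tsum (Finset.range n) fun i _ => level_sum_nonneg w hab i) hD'.le
        rw [levelLog_zero] at h1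
        linarith
    rw [div_mul_eq_mul_div, div_le_iff₀ hD']
    linarith
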